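/- If G is a connected, pointed graph (every leaf block is an edge block) that is neither a single 2-connected block nor a star, then G contains a near-leaf block. -/

import Mathlib

/-- A vertex set `B` induces a 2-connected subgraph of `G` (where a single vertex or a
single edge counts as 2-connected): the induced graph is connected, and removing any
single vertex leaves it connected. -/
def IsTwoConnectedSet {V : Type*} (G : SimpleGraph V) (B : Set V) : Prop :=
  B.Nonempty ∧ (G.induce B).Connected ∧
    ∀ v ∈ B, (B \ {v}).Nonempty → (G.induce (B \ {v})).Connected

/-- A block of `G`: a maximal 2-connected vertex set. -/
def IsBlock {V : Type*} (G : SimpleGraph V) (B : Set V) : Prop :=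
  IsTwoConnectedSet G B ∧ ∀ B' : Set V, IsTwoConnectedSet G B' → B ⊆ B' → B = B'

/-- `v` is a cut-vertex of `G`: removing `v` disconnects two vertices that were
reachable from each other, i.e. it increases the number of connected components. -/
def IsCutVertex {V : Type*} (G : SimpleGraph V) (v : V) : Prop :=
  ∃ (a b : V) (ha : a ≠ v) (hb : b ≠ v), G.Reachable a b ∧
    ¬ (G.induce {x : V | x ≠ v}).Reachable ⟨a, ha⟩ ⟨b, hb⟩

/-- A leaf block: a block containing exactly one cut-vertex of `G`. -/
def IsLeafBlock {V : Type*} (G : SimpleGraph V) (B : Set V) : Prop :=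
  IsBlock G B ∧ ∃! v : V, v ∈ B ∧ IsCutVertex G v

/-- An internal block: a block containing at least two cut-vertices of `G`. -/
def IsInternalBlock {V : Type*} (G : SimpleGraph V) (B : Set V) : Prop :=
  IsBlock G B ∧ ∃ u v : V, u ≠ v ∧ u ∈ B ∧ v ∈ B ∧ IsCutVertex G u ∧ IsCutVertex G v

/-- A near-leaf block: an internal block `Q` such that either all internal-block
neighbours of `Q` meet `Q` in one common cut-vertex (the anchor), or all block
neighbours of `Q` are leaf blocks. -/
def IsNearLeafBlock {V : Type*} (G : SimpleGraph V) (Q : Set V) : Prop :=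
  IsInternalBlock G Q ∧
    ((∃ a, a ∈ Q ∧ IsCutVertex G a ∧
        ∀ B : Set V, IsInternalBlock G B → B ≠ Q → (B ∩ Q).Nonempty → a ∈ B) ∨
      (∀ B : Set V, IsBlock G B → B ≠ Q → (B ∩ Q).Nonempty → IsLeafBlock G B))

/-- `G` is pointed: every leaf block of `G` is an edge block (has exactly two vertices). -/
def IsPointed {V : Type*} (G : SimpleGraph V) : Prop :=
  ∀ B : Set V, IsLeafBlock G B → ∃ u v : V, u ≠ v ∧ B = {u, v}

/-- `G` is a star `K_{1,m}`: some centre `c` is adjacent exactly to all other vertices. -/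
def IsStar {V : Type*} (G : SimpleGraph V) : Prop :=
  ∃ c : V, ∀ u v : V, G.Adj u v ↔ ((u = c ∧ v ≠ c) ∨ (v = c ∧ u ≠ c))

namespace NearLeaf

open SimpleGraph

variable {V : Type*} {G : SimpleGraph V}

/-- A path splits at `y`; one of the two halves avoids `x ≠ y`. -/
lemma path_split {u v x y : V} (p : G.Walk u v) (hp : p.IsPath) (hy : y ∈ p.support)
    (hxy : x ≠ y) :
    (∃ q : G.Walk u y, x ∉ q.support ∧ q.support ⊆ p.support) ∨
    (∃ q : G.Walk y v, x ∉ q.support ∧ q.support ⊆ p.support) := by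
  classical
  by_cases h : x ∈ (p.takeUntil y hy).support
  · right
    refine ⟨p.dropUntil y hy, ?_, p.support_dropUntil_subset_support hy⟩
    intro hx
    have hn := hp.support_nodup
    rw [← p.take_spec hy, Walk.support_append] at hn
    have hd := (List.nodup_append.1 hn).2.2
    rw [Walk.mem_support_iff] at hx
    rcases hx with hx | hx
    · exact hxy hx
    · exact hd x h x hx rfl
  · left
    exact ⟨_, h, p.support_takeUntil_subset_support hy⟩

/-- Vertices of a connected induced set are joined by a walk inside the set. -/
lemma exists_walk_in {S : Set V} {a b : V} (ha : a ∈ S) (hb : b ∈ S)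
    (h : (G.induce S).Reachable ⟨a, ha⟩ ⟨b, hb⟩) :
    ∃ p : G.Walk a b, ∀ x ∈ p.support, x ∈ S := by
  obtain ⟨p⟩ := h
  refine ⟨p.map (Embedding.induce S).toHom, ?_⟩
  intro x hx
  erw [Walk.support_map, List.mem_map] at hx
  obtain ⟨y, -, rfl⟩ := hx
  exact y.2

lemma diff_conn {B : Set V} (hB : IsTwoConnectedSet G B) {x w : V} (hw : w ∈ B) (hxw : x ≠ w) :
    (G.induce (B \ {x})).Connected := by
  have hw' : w ∈ B \ {x} := ⟨hw, fun h => hxw h.symm⟩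
  by_cases hx : x ∈ B
  · exact hB.2.2 x hx ⟨w, hw'⟩
  · rw [Set.sdiff_singleton_eq_self hx]; exact hB.2.1

/-- Two 2-connected sets sharing `w`, joined by a path avoiding `w`, have a 2-connected union. -/
lemma union_twoConn {B Q : Set V} (hB : IsTwoConnectedSet G B) (hQ : IsTwoConnectedSet G Q)
    {w b q : V} (hwB : w ∈ B) (hwQ : w ∈ Q) (hb : b ∈ B) (hq : q ∈ Q)
    (p : G.Walk b q) (hp : p.IsPath) (hw : w ∉ p.support) :
    IsTwoConnectedSet G (B ∪ Q ∪ {x | x ∈ p.support}) := by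
  have hbw : b ≠ w := fun h => hw (h ▸ p.start_mem_support)
  have hqw : q ≠ w := fun h => hw (h ▸ p.end_mem_support)
  refine ⟨⟨w, Or.inl (Or.inl hwB)⟩, ?_, ?_⟩
  · refine induce_union_connected (induce_union_connected hB.2.1.preconnected
      hQ.2.1.preconnected ⟨w, hwB, hwQ⟩).preconnected p.connected_induce_support.preconnected ?_
    exact ⟨b, Or.inl hb, p.start_mem_support⟩
  · intro x _ _
    by_cases hxw : x = w
    · subst hxw
      have h1 := induce_union_connected (diff_conn hB hb hbw.symm).preconnected
        p.connected_induce_support.preconnected ⟨b, ⟨hb, hbw⟩, p.start_mem_support⟩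
      have h2 := induce_union_connected h1.preconnected
        (diff_conn hQ hq hqw.symm).preconnected ⟨q, Or.inr p.end_mem_support, hq, hqw⟩
      suffices heq : (B ∪ Q ∪ {y | y ∈ p.support}) \ {x} =
          B \ {x} ∪ {y | y ∈ p.support} ∪ Q \ {x} by
        rw [heq]
        exact h2
      ext y
      simp only [Set.mem_sdiff, Set.mem_union, Set.mem_singleton_iff]
      constructor
      · tauto
      · rintro ((h | h) | h)
        · tauto
        · refine ⟨Or.inr h, ?_⟩
          rintro rfl
          exact hw h
        · tauto
    · have hBx := diff_conn hB hwB hxw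
      have hQx := diff_conn hQ hwQ hxw
      have hwx : w ≠ x := fun h => hxw h.symm
      refine induce_connected_of_patches w ⟨Or.inl (Or.inl hwB), hwx⟩ ?_
      rintro y ⟨hy, hyx⟩
      have hyx' : x ≠ y := fun h => hyx h.symm
      rcases hy with (hy | hy) | hy
      · exact ⟨B \ {x}, fun z hz => ⟨Or.inl (Or.inl hz.1), hz.2⟩, ⟨hwB, hwx⟩, ⟨hy, hyx⟩,
          hBx.preconnected _ _⟩
      · exact ⟨Q \ {x}, fun z hz => ⟨Or.inl (Or.inr hz.1), hz.2⟩, ⟨hwQ, hwx⟩, ⟨hy, hyx⟩,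
          hQx.preconnected _ _⟩
      · rcases path_split p hp hy hyx' with ⟨r, hr, hrs⟩ | ⟨r, hr, hrs⟩
        · refine ⟨(B \ {x}) ∪ {z | z ∈ r.support}, ?_, Or.inl ⟨hwB, hwx⟩,
            Or.inr r.end_mem_support, ?_⟩
          · rintro z (hz | hz)
            · exact ⟨Or.inl (Or.inl hz.1), hz.2⟩
            · refine ⟨Or.inr (hrs hz), ?_⟩
              rintro rfl
              exact hr hz
          · refine (induce_union_connected hBx.preconnected
              r.connected_induce_support.preconnected
              ⟨b, ⟨hb, ?_⟩, r.start_mem_support⟩).preconnected _ _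
            rintro rfl
            exact hr r.start_mem_support
        · refine ⟨(Q \ {x}) ∪ {z | z ∈ r.support}, ?_, Or.inl ⟨hwQ, hwx⟩,
            Or.inr r.start_mem_support, ?_⟩
          · rintro z (hz | hz)
            · exact ⟨Or.inl (Or.inr hz.1), hz.2⟩
            · refine ⟨Or.inr (hrs hz), ?_⟩
              rintro rfl
              exact hr hz
          · refine (induce_union_connected hQx.preconnected
              r.connected_induce_support.preconnected
              ⟨q, ⟨hq, ?_⟩, r.end_mem_support⟩).preconnected _ _
            rintro rfl
            exact hr r.end_mem_support

/-- Distinct blocks sharing `w` are separated by `w`. -/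
lemma block_sep {B Q : Set V} (hB : IsBlock G B) (hQ : IsBlock G Q) (hne : B ≠ Q)
    {w b q : V} (hwB : w ∈ B) (hwQ : w ∈ Q) (hb : b ∈ B) (hq : q ∈ Q)
    (p : G.Walk b q) (hw : w ∉ p.support) : False := by
  classical
  have h := union_twoConn hB.1 hQ.1 hwB hwQ hb hq p.bypass p.bypass_isPath
    (fun h => hw (p.support_bypass_subset_support h))
  exact hne ((hB.2 _ h fun z hz => Or.inl (Or.inl hz)).trans
    (hQ.2 _ h fun z hz => Or.inl (Or.inr hz)).symm)

lemma block_exists_other {B Q : Set V} (hB : IsBlock G B) (hQ : IsBlock G Q) (hne : B ≠ Q)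
    {w : V} (hwQ : w ∈ Q) : ∃ b ∈ B, b ≠ w := by
  by_contra! h
  exact hne (hB.2 Q hQ.1 fun z hz => by rw [h z hz]; exact hwQ)

/-- A vertex shared by two distinct blocks is a cut-vertex. -/
lemma cut_of_shared (hc : G.Connected) {B Q : Set V} (hB : IsBlock G B) (hQ : IsBlock G Q)
    (hne : B ≠ Q) {w : V} (hwB : w ∈ B) (hwQ : w ∈ Q) : IsCutVertex G w := by
  obtain ⟨b, hb, hbw⟩ := block_exists_other hB hQ hne hwQ
  obtain ⟨q, hq, hqw⟩ := block_exists_other hQ hB hne.symm hwB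
  refine ⟨b, q, hbw, hqw, hc.preconnected b q, fun h => ?_⟩
  obtain ⟨p, hp⟩ := exists_walk_in (S := {x | x ≠ w}) hbw hqw h
  exact block_sep hB hQ hne hwB hwQ hb hq p fun hw => hp w hw rfl

/-- The vertices reachable from `Q` by a connected set avoiding `v`. -/
def side (G : SimpleGraph V) (v : V) (Q : Set V) : Set V :=
  {x | ∃ S : Set V, (G.induce S).Connected ∧ v ∉ S ∧ x ∈ S ∧ ∃ y ∈ Q, y ∈ S}

lemma side_ssubset {B Q : Set V} (hB : IsBlock G B) (hQ : IsBlock G Q) (hne : B ≠ Q)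
    {v w : V} (hvQ : v ∈ Q) (hvB : v ∉ B) (hwB : w ∈ B) (hwQ : w ∈ Q) :
    side G w B ⊂ side G v Q := by
  rw [Set.ssubset_iff_exists]
  refine ⟨?_, w, ⟨B, hB.1.2.1, hvB, hwB, w, hwQ, hwB⟩, ?_⟩
  · rintro x ⟨S, hS, hwS, hxS, y, hyB, hyS⟩
    have hvS : v ∉ S := by
      intro hvS
      obtain ⟨p, hp⟩ := exists_walk_in hyS hvS (hS.preconnected _ _)
      exact block_sep hB hQ hne hwB hwQ hyB hvQ p fun h => hwS (hp w h)
    refine ⟨S ∪ B, induce_union_connected hS.preconnected hB.1.2.1.preconnected ⟨y, hyS, hyB⟩,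
      ?_, Or.inl hxS, w, hwQ, Or.inr hwB⟩
    rintro (h | h)
    · exact hvS h
    · exact hvB h
  · rintro ⟨S, -, hwS, hxS, -⟩
    exact hwS hxS

/-- An internal block yields a near-leaf block. -/
lemma nearLeaf_of_internal [Finite V] (hc : G.Connected) (n : ℕ) :
    ∀ (Q : Set V) (v : V), IsInternalBlock G Q → v ∈ Q → IsCutVertex G v →
      (side G v Q).ncard = n → ∃ Q : Set V, IsNearLeafBlock G Q := by
  induction n using Nat.strong_induction_on with
  | _ n ih =>
    intro Q v hQ hv hcut hn
    by_cases h : ∀ B : Set V, IsInternalBlock G B → B ≠ Q → (B ∩ Q).Nonempty → v ∈ B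
    · exact ⟨Q, hQ, Or.inl ⟨v, hv, hcut, h⟩⟩
    · push Not at h
      obtain ⟨B, hB, hne, ⟨w, hwB, hwQ⟩, hvB⟩ := h
      have hlt := Set.ncard_lt_ncard (side_ssubset hB.1 hQ.1 hne hv hvB hwB hwQ) (Set.toFinite _)
      exact ih _ (hn ▸ hlt) B w hB hwB (cut_of_shared hc hB.1 hQ.1 hne hwB hwQ) rfl

lemma conn_singleton (x : V) : (G.induce {x}).Connected := by
  have : Nonempty ({x} : Set V) := ⟨⟨x, rfl⟩⟩
  refine ⟨fun a b => ?_⟩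
  have : a = b := Subsingleton.elim _ _
  rw [this]

lemma edge_twoConn {x y : V} (h : G.Adj x y) : IsTwoConnectedSet G {x, y} := by
  refine ⟨⟨x, by simp⟩, induce_pair_connected_of_adj h, ?_⟩
  have hne := h.ne
  rintro v (rfl | rfl) _
  · have : ({v, y} : Set V) \ {v} = {y} := by ext z; simp; grind
    rw [this]; exact conn_singleton y
  · have : ({x, v} : Set V) \ {v} = {x} := by ext z; simp; grind
    rw [this]; exact conn_singleton x

lemma exists_block [Finite V] {S : Set V} (h : IsTwoConnectedSet G S) :
    ∃ B, S ⊆ B ∧ IsBlock G B := by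
  obtain ⟨B, hSB, hB⟩ := (Set.toFinite {B : Set V | IsTwoConnectedSet G B}).exists_le_maximal h
  exact ⟨B, hSB, hB.1, fun B' h' hle => Set.Subset.antisymm hle (hB.2 h' hle)⟩

lemma block_has_cut [Finite V] (hc : G.Connected) (h2 : ¬ IsTwoConnectedSet G Set.univ)
    {B : Set V} (hB : IsBlock G B) : ∃ v ∈ B, IsCutVertex G v := by
  obtain ⟨b, hb⟩ := hB.1.1
  have hne : B ≠ Set.univ := fun h => h2 (h ▸ hB.1)
  obtain ⟨z, hz⟩ := (Set.ne_univ_iff_exists_notMem B).1 hne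
  obtain ⟨p⟩ := hc.preconnected b z
  obtain ⟨d, -, hd1, hd2⟩ := p.exists_boundary_dart B hb hz
  obtain ⟨B', hs, hB'⟩ := exists_block (edge_twoConn d.adj)
  refine ⟨d.fst, hd1, cut_of_shared hc hB hB' ?_ hd1 (hs (by simp))⟩
  rintro rfl
  exact hd2 (hs (by simp))

lemma exists_internal [Finite V] (hc : G.Connected) (hp : IsPointed G)
    (h2 : ¬ IsTwoConnectedSet G Set.univ) (hs : ¬ IsStar G) :
    ∃ Q : Set V, IsInternalBlock G Q := by
  by_contra! hno
  have huniq : ∀ B, IsBlock G B → ∀ u v, u ∈ B → v ∈ B → IsCutVertex G u → IsCutVertex G v →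
      u = v := by
    intro B hB u v hu hv hcu hcv
    by_contra hne
    exact hno B ⟨hB, u, v, hne, hu, hv, hcu, hcv⟩
  have hedge : ∀ x y, G.Adj x y → IsBlock G {x, y} := by
    intro x y hxy
    obtain ⟨B, hsub, hB⟩ := exists_block (edge_twoConn hxy)
    obtain ⟨c, hcB, hcut⟩ := block_has_cut hc h2 hB
    obtain ⟨u, v, huv, rfl⟩ := hp B ⟨hB, c, ⟨hcB, hcut⟩,
      fun d hd => huniq B hB d c hd.1 hcB hd.2 hcut⟩
    have hx : x ∈ ({u, v} : Set V) := hsub (by simp)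
    have hy : y ∈ ({u, v} : Set V) := hsub (by simp)
    have hne := hxy.ne
    have : ({u, v} : Set V) = {x, y} := by
      rcases hx with rfl | rfl <;> rcases hy with rfl | rfl
      · exact absurd rfl hne
      · rfl
      · exact Set.pair_comm _ _
      · exact absurd rfl hne
    rwa [this] at hB
  -- pick a cut vertex
  obtain ⟨x0⟩ := hc.nonempty
  have h1 : IsTwoConnectedSet G {x0} := by
    refine ⟨⟨x0, rfl⟩, conn_singleton x0, ?_⟩
    rintro v rfl ⟨z, hz⟩
    exact absurd hz.1 hz.2
  obtain ⟨B0, -, hB0⟩ := exists_block h1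
  obtain ⟨c, -, hcut⟩ := block_has_cut hc h2 hB0
  -- neighbours of c have c as their only neighbour
  have hnb : ∀ x y, G.Adj c x → G.Adj x y → y = c := by
    intro x y hcx hxy
    by_contra hyc
    have hne : ({c, x} : Set V) ≠ {x, y} := by
      intro h
      have : y ∈ ({c, x} : Set V) := by rw [h]; simp
      rcases this with h | h
      · exact hyc h
      · exact hxy.ne h.symm
    have hx := cut_of_shared hc (hedge _ _ hcx) (hedge _ _ hxy) hne (w := x) (by simp) (by simp)
    exact hcx.ne (huniq _ (hedge _ _ hcx) c x (by simp) (by simp) hcut hx)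
  have hall : ∀ v, v ≠ c → G.Adj c v := by
    intro v hv
    by_contra hcv
    obtain ⟨p⟩ := hc.preconnected c v
    obtain ⟨d, -, hd1, hd2⟩ := p.exists_boundary_dart {z | z = c ∨ G.Adj c z} (Or.inl rfl)
      (by rintro (h | h); exacts [hv h, hcv h])
    have had := d.adj
    rcases hd1 with h | h
    · rw [h] at had
      exact hd2 (Or.inr had)
    · exact hd2 (Or.inl (hnb _ _ h had))
  apply hs
  refine ⟨c, fun u v => ⟨fun h => ?_, ?_⟩⟩
  · by_cases hu : u = c
    · left
      exact ⟨hu, fun hv => h.ne (hu.trans hv.symm)⟩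
    · right
      exact ⟨hnb u v (hall u hu) h, hu⟩
  · rintro (⟨rfl, h⟩ | ⟨rfl, h⟩)
    · exact hall v h
    · exact (hall u h).symm

end NearLeaf

/-- A connected, pointed graph that is neither a single block nor a star contains
a near-leaf block. -/
theorem pointed_has_nearLeafBlock {V : Type*} [Fintype V] (G : SimpleGraph V)
    (hc : G.Connected) (hp : IsPointed G)
    (h2 : ¬ IsTwoConnectedSet G Set.univ) (hs : ¬ IsStar G) :
    ∃ Q : Set V, IsNearLeafBlock G Q := by
  obtain ⟨Q, hQ⟩ := NearLeaf.exists_internal hc hp h2 hs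
  obtain ⟨v, -, -, hv, -, hcut, -⟩ := hQ.2
  exact NearLeaf.nearLeaf_of_internal hc _ Q v hQ hv hcut rfl
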